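/- Let j ≥ 3 and let τ = τ_1⋯τ_j ∈ S_j with τ_1 = 1 and τ_j = 2. Then τ is minimal overlapping, i.e. the smallest n such that there exists σ ∈ S_n with τ-mch(σ) = 2 is 2j−1. -/

import Mathlib

open scoped Classical

noncomputable section

namespace CWilf

/-- The number of descents of a permutation of `{0, …, n-1}` (0-based). -/
def des {n : ℕ} (σ : Equiv.Perm (Fin n)) : ℕ :=
  (Finset.univ.filter fun i : Fin n =>
    ∃ h : (i : ℕ) + 1 < n, σ ⟨(i : ℕ) + 1, h⟩ < σ i).card

/-- The number of inversions of `σ`. -/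
def inv {n : ℕ} (σ : Equiv.Perm (Fin n)) : ℕ :=
  (Finset.univ.filter fun q : Fin n × Fin n => q.1 < q.2 ∧ σ q.2 < σ q.1).card

/-- The number of coinversions of `σ`. -/
def coinv {n : ℕ} (σ : Equiv.Perm (Fin n)) : ℕ :=
  (Finset.univ.filter fun q : Fin n × Fin n => q.1 < q.2 ∧ σ q.1 < σ q.2).card

/-- The number of left-to-right minima of `σ`. -/
def LRmin {n : ℕ} (σ : Equiv.Perm (Fin n)) : ℕ :=
  (Finset.univ.filter fun j : Fin n => ∀ i : Fin n, i < j → σ j < σ i).card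

/-- There is a `τ`-match of `σ` starting at (0-based) position `i`, i.e.
`red(σ_i σ_{i+1} ⋯ σ_{i+j-1}) = τ`. -/
def MatchAt {j n : ℕ} (τ : Equiv.Perm (Fin j)) (σ : Equiv.Perm (Fin n)) (i : ℕ) : Prop :=
  ∃ h : i + j ≤ n, ∀ a b : Fin j,
    τ a < τ b ↔
      σ ⟨i + (a : ℕ), by have := a.isLt; omega⟩ < σ ⟨i + (b : ℕ), by have := b.isLt; omega⟩

/-- The number of `τ`-matches of `σ`. -/
def mch {j n : ℕ} (τ : Equiv.Perm (Fin j)) (σ : Equiv.Perm (Fin n)) : ℕ :=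
  ((Finset.range n).filter fun i => MatchAt τ σ i).card

/-- `τ` is minimal overlapping: the smallest `n` such that some `σ ∈ S_n` has
exactly two `τ`-matches is `2j - 1`. -/
def MinOverlapping {j : ℕ} (τ : Equiv.Perm (Fin j)) : Prop :=
  IsLeast {n : ℕ | ∃ σ : Equiv.Perm (Fin n), mch τ σ = 2} (2 * j - 1)

/-- `α` and `β` are mutually minimal overlapping. -/
def MutuallyMinOverlapping {j : ℕ} (α β : Equiv.Perm (Fin j)) : Prop :=
  MinOverlapping α ∧ MinOverlapping β ∧
    IsLeast {n : ℕ | ∃ σ : Equiv.Perm (Fin n), 1 ≤ mch α σ ∧ 1 ≤ mch β σ} (2 * j - 1)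

/-- The set of permutations of `S_n` with no `τ`-match. -/
def NM (n : ℕ) {j : ℕ} (τ : Equiv.Perm (Fin j)) : Finset (Equiv.Perm (Fin n)) :=
  Finset.univ.filter fun σ => mch τ σ = 0


theorem MatchAt.le_of_lt {j n : ℕ} {τ : Equiv.Perm (Fin j)}
    (hfirst : ∀ a, (τ a : ℕ) = 0 ↔ (a : ℕ) = 0) (hlast : ∀ a, (τ a : ℕ) = 1 ↔ (a : ℕ) = j - 1)
    {σ : Equiv.Perm (Fin n)} {i k : ℕ} (hi : MatchAt τ σ i) (hk : MatchAt τ σ k)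
    (hik : i < k) : i + (j - 1) ≤ k := by
  by_contra! hlt
  obtain ⟨_, hi⟩ := hi
  obtain ⟨_, hk⟩ := hk
  obtain ⟨d, rfl⟩ := Nat.exists_eq_add_of_lt hik
  obtain ⟨r, rfl⟩ : ∃ r, j = d + 1 + (r + 1) + 1 := ⟨j - (d + 3), by omega⟩
  let z : Fin (d + 1 + (r + 1) + 1) := ⟨0, by omega⟩
  let m : Fin (d + 1 + (r + 1) + 1) := ⟨d + 1, by omega⟩
  let s : Fin (d + 1 + (r + 1) + 1) := ⟨r + 1, by omega⟩
  let l : Fin (d + 1 + (r + 1) + 1) := ⟨d + 1 + (r + 1), by omega⟩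
  have hz : (τ z : ℕ) = 0 := (hfirst z).2 rfl
  have hl : (τ l : ℕ) = 1 := (hlast l).2 rfl
  have hm0 : (τ m : ℕ) ≠ 0 := fun h => absurd ((hfirst m).1 h) (by simp [m])
  have hm1 : (τ m : ℕ) ≠ 1 := fun h => absurd ((hlast m).1 h) (by simp [m])
  have hs : (τ s : ℕ) ≠ 0 := fun h => absurd ((hfirst s).1 h) (by simp [s])
  have h1 := (hi l m).1 (by rw [Fin.lt_def]; omega)
  have h2 := (hk z s).1 (by rw [Fin.lt_def]; omega)
  have e : i + d + 1 + (r + 1) = i + (d + 1 + (r + 1)) := by omega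
  simp only [z, s, e, add_zero] at h2
  exact lt_asymm h1 h2

/-- The word of length `2 * j - 1` that begins with `τ` and continues with the letters of `τ`
after the first, raised by `j - 1`. -/
def doubleWord {j : ℕ} (τ : Equiv.Perm (Fin j)) (p : Fin (2 * j - 1)) : Fin (2 * j - 1) :=
  if h : (p : ℕ) < j then ⟨τ ⟨p, h⟩, by omega⟩
  else ⟨τ ⟨p - (j - 1), by omega⟩ + (j - 1), by omega⟩

theorem doubleWord_injective {j : ℕ} {τ : Equiv.Perm (Fin j)}
    (hfirst : ∀ a, (τ a : ℕ) = 0 ↔ (a : ℕ) = 0) : Function.Injective (doubleWord τ) := by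
  have inj (a b : Fin j) (h : (τ a : ℕ) = τ b) : (a : ℕ) = b :=
    congrArg Fin.val (τ.injective (Fin.ext h))
  intro p q h
  rw [Fin.ext_iff] at h ⊢
  unfold doubleWord at h
  split_ifs at h with hp hq hq <;> dsimp only at h
  · exact inj _ _ h
  · have := hfirst ⟨q - (j - 1), by omega⟩
    dsimp only at this
    omega
  · have := hfirst ⟨p - (j - 1), by omega⟩
    dsimp only at this
    omega
  · have := inj _ _ (Nat.add_right_cancel h)
    dsimp only at this
    omega

/-- `doubleWord τ` as a permutation. -/
def doublePerm {j : ℕ} (τ : Equiv.Perm (Fin j)) (hfirst : ∀ a, (τ a : ℕ) = 0 ↔ (a : ℕ) = 0) :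
    Equiv.Perm (Fin (2 * j - 1)) :=
  Equiv.ofBijective (doubleWord τ)
    (Finite.injective_iff_bijective.1 (doubleWord_injective hfirst))

theorem matchAt_zero_doublePerm {j : ℕ} (hj : 0 < j) (τ : Equiv.Perm (Fin j))
    (hfirst : ∀ a, (τ a : ℕ) = 0 ↔ (a : ℕ) = 0) : MatchAt τ (doublePerm τ hfirst) 0 := by
  refine ⟨by omega, fun a b => ?_⟩
  simp [doublePerm, doubleWord]

theorem matchAt_sub_one_doublePerm {j : ℕ} (hj : 0 < j) (τ : Equiv.Perm (Fin j))
    (hfirst : ∀ a, (τ a : ℕ) = 0 ↔ (a : ℕ) = 0) (hlast : ∀ a, (τ a : ℕ) = 1 ↔ (a : ℕ) = j - 1) :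
    MatchAt τ (doublePerm τ hfirst) (j - 1) := by
  have val (a : Fin j) (h : j - 1 + (a : ℕ) < 2 * j - 1) :
      (doublePerm τ hfirst ⟨j - 1 + (a : ℕ), h⟩ : ℕ) =
        if (a : ℕ) = 0 then 1 else (τ a : ℕ) + (j - 1) := by
    by_cases ha : (a : ℕ) = 0
    · simp [doublePerm, doubleWord, ha, hlast, hj]
    · simp [doublePerm, doubleWord, ha, show ¬ j - 1 + (a : ℕ) < j by omega]
  refine ⟨by omega, fun a b => ?_⟩
  rw [Fin.lt_def, Fin.lt_def, val, val]
  have ha := hfirst a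
  have hb := hfirst b
  split_ifs <;> omega

/-- Theorem: any `τ ∈ S_j` (`j ≥ 3`) with `τ_1 = 1` and `τ_j = 2` is minimal
overlapping: the smallest `n` such that some `σ ∈ S_n` has exactly two `τ`-matches
is `2j - 1`. -/
theorem stmt13 {j : ℕ} (hj : 3 ≤ j) (τ : Equiv.Perm (Fin j))
    (hfirst : τ ⟨0, by omega⟩ = ⟨0, by omega⟩)
    (hlast : τ ⟨j - 1, by omega⟩ = ⟨1, by omega⟩) :
    MinOverlapping τ := by
  replace hfirst (a : Fin j) : (τ a : ℕ) = 0 ↔ (a : ℕ) = 0 := by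
    simpa only [hfirst, Fin.ext_iff] using τ.injective.eq_iff (a := a) (b := ⟨0, by omega⟩)
  replace hlast (a : Fin j) : (τ a : ℕ) = 1 ↔ (a : ℕ) = j - 1 := by
    simpa only [hlast, Fin.ext_iff] using τ.injective.eq_iff (a := a) (b := ⟨j - 1, by omega⟩)
  constructor
  · have hpos : 0 < j := by omega
    refine ⟨doublePerm τ hfirst, ?_⟩
    have h0 := matchAt_zero_doublePerm hpos τ hfirst
    have h1 := matchAt_sub_one_doublePerm hpos τ hfirst hlast
    rw [mch, Finset.card_eq_two]
    refine ⟨0, j - 1, by omega, ?_⟩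
    ext i
    simp only [Finset.mem_filter, Finset.mem_range, Finset.mem_insert, Finset.mem_singleton]
    constructor
    · rintro ⟨-, h⟩
      have hle := h.1
      rcases Nat.eq_zero_or_pos i with hi | hi
      · exact Or.inl hi
      · have := MatchAt.le_of_lt hfirst hlast h0 h hi
        omega
    · rintro (rfl | rfl)
      · exact ⟨by omega, h0⟩
      · exact ⟨by omega, h1⟩
  · rintro n ⟨σ, hσ⟩
    obtain ⟨i, hi, k, hk, hik⟩ := Finset.one_lt_card.1 (hσ ▸ one_lt_two : 1 < mch τ σ)
    have hi := (Finset.mem_filter.1 hi).2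
    have hk := (Finset.mem_filter.1 hk).2
    have hin := hi.1
    have hkn := hk.1
    rcases hik.lt_or_gt with h | h
    · have := MatchAt.le_of_lt hfirst hlast hi hk h
      omega
    · have := MatchAt.le_of_lt hfirst hlast hk hi h
      omega

end CWilf
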